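/- arXiv:0910.5212 — 4 statements merged into one kernel-verified Lean document; each statement's English description precedes it below -/
import Mathlib

section
/- Let E be a real inner product space, ρ, λ, α ∈ E, and define c(μ) := ⟨μ, μ⟩ + 2⟨μ, ρ⟩ for μ ∈ E. Let n be a real number with n > 0 and δ a real number. If (n(n−1)/2 − δ)·c(2λ − α) = (n − 2)·n·c(λ), then (n − 1 − 2δ/n)·( ⟨α, ρ⟩ + ‖α‖²/2 − ‖λ − α‖² ) = (1 − 2δ/n)·c(λ). (This is the key computation in the alternating case of the proof of Theorem 1: here n = dim(V_λ), Λ²(V_λ) = V_μ ⊕ k^δ with μ = 2λ − α, and the hypothesis expresses the index relation l(V_μ) = (n−2)·l(V_λ) via the Casimir formula κ·l(V_μ) = dim(V_μ)·c(μ).) -/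
open RealInnerProductSpace

theorem stmt_13 {E : Type*} [NormedAddCommGroup E] [InnerProductSpace ℝ E]
    (ρ lam α : E) (c : E → ℝ) (hc : ∀ μ : E, c μ = ⟪μ, μ⟫ + 2 * ⟪μ, ρ⟫)
    (n δ : ℝ) (hn : 0 < n)
    (h : (n * (n - 1) / 2 - δ) * c ((2 : ℝ) • lam - α) = (n - 2) * n * c lam) :
    (n - 1 - 2 * δ / n) * (⟪α, ρ⟫ + ‖α‖ ^ 2 / 2 - ‖lam - α‖ ^ 2) =
      (1 - 2 * δ / n) * c lam := by
  have key : c ((2 : ℝ) • lam - α) =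
      2 * c lam - 2 * (⟪α, ρ⟫ + ‖α‖ ^ 2 / 2 - ‖lam - α‖ ^ 2) := by
    rw [hc, hc, ← real_inner_self_eq_norm_sq, ← real_inner_self_eq_norm_sq]
    simp only [inner_sub_left, inner_sub_right, real_inner_smul_left, real_inner_smul_right]
    rw [real_inner_comm lam α]
    ring
  rw [key] at h
  generalize ⟪α, ρ⟫ + ‖α‖ ^ 2 / 2 - ‖lam - α‖ ^ 2 = X at h ⊢
  have hn' : n ≠ 0 := hn.ne'
  field_simp
  linarith
end

section
/- Let E be a real inner product space, ρ, λ, α ∈ E, and define c(μ) := ⟨μ, μ⟩ + 2⟨μ, ρ⟩. Let n be a real number with n > 2 and δ ∈ {0, 1}. Assume (n − 1 − 2δ/n)·( ⟨α, ρ⟩ + ‖α‖²/2 − ‖λ − α‖² ) = (1 − 2δ/n)·c(λ), c(λ) > 0, and ⟨α, ρ⟩ = ‖α‖²/2. Then 2·⟨α, λ⟩ − ‖λ‖² > 0. (In the alternating case of the proof of Theorem 1, this positivity follows since 2δ/n < 1 and ⟨α, ρ⟩ = ‖α‖²/2 holds for a simple positive root α.) -/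
open RealInnerProductSpace

theorem stmt_14 {E : Type*} [NormedAddCommGroup E] [InnerProductSpace ℝ E]
    (ρ lam α : E) (c : E → ℝ) (hc : ∀ μ : E, c μ = ⟪μ, μ⟫ + 2 * ⟪μ, ρ⟫)
    (n δ : ℝ) (hn : 2 < n) (hδ : δ = 0 ∨ δ = 1)
    (h : (n - 1 - 2 * δ / n) * (⟪α, ρ⟫ + ‖α‖ ^ 2 / 2 - ‖lam - α‖ ^ 2) =
      (1 - 2 * δ / n) * c lam)
    (hcpos : 0 < c lam) (hα : ⟪α, ρ⟫ = ‖α‖ ^ 2 / 2) :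
    0 < 2 * ⟪α, lam⟫ - ‖lam‖ ^ 2 := by
  have hd : 2 * δ / n < 1 := by
    rw [div_lt_one (by linarith)]
    rcases hδ with h0 | h0 <;> rw [h0] <;> linarith
  have hpos : 0 < (1 - 2 * δ / n) * c lam := mul_pos (by linarith) hcpos
  rw [← h] at hpos
  have h2 := (mul_pos_iff_of_pos_left (by linarith)).mp hpos
  rw [norm_sub_sq_real, hα, real_inner_comm] at h2
  linarith
end

section
/- Let m ≥ 1 and 1 ≤ r ≤ m be integers, and define λ_i := 1 for 1 ≤ i ≤ r and λ_i := 0 for r < i ≤ m. Then in ℚ: ∏_{1 ≤ i < j ≤ m} ( (λ_i − λ_j)/(j − i) + 1 ) · ∏_{1 ≤ i < j ≤ m} ( (λ_i + λ_j)/(2m + 1 − i − j) + 1 ) = C(2m, r) − C(2m, r−1), where C(·,·) denotes the binomial coefficient. (This identifies the Kac–Weyl superdimension of the irreducible 𝔬𝔰𝔭(1|2m)-representation with highest weight ε_1 + ⋯ + ε_r with C(2m, r) − C(2m, r−1), as used in the proof of Lemma 3.) -/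
open Finset

/-- Telescoping: rational differences. -/
lemma aux_c1 (i r n : ℕ) (hi : i ≤ r) (hn : r ≤ n) :
    ∏ j ∈ Finset.Ioc r n, ((1 : ℚ) / ((j : ℚ) - i) + 1) = ((n : ℚ) - i + 1) / ((r : ℚ) - i + 1) := by
  have hi' : (i : ℚ) ≤ r := by exact_mod_cast hi
  induction n, hn using Nat.le_induction with
  | base => 
    have : (r : ℚ) - i + 1 ≠ 0 := by linarith
    simp [div_self this]
  | succ n hn ih =>
    have hn' : (r : ℚ) ≤ n := by exact_mod_cast hn
    rw [Finset.prod_Ioc_succ_top hn, ih]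
    have h1 : (r : ℚ) - i + 1 ≠ 0 := by linarith
    have h2 : (n : ℚ) + 1 - i ≠ 0 := by linarith
    push_cast
    field_simp
    ring

lemma aux_c2 (m i r n : ℕ) (hi : i ≤ r) (hn : r ≤ n) (hm : n ≤ m) :
    ∏ j ∈ Finset.Ioc r n, ((1 : ℚ) / ((2 * m + 1 : ℚ) - i - j) + 1)
      = ((2 * m + 1 : ℚ) - i - r) / ((2 * m + 1 : ℚ) - i - n) := by
  have hi' : (i : ℚ) ≤ r := by exact_mod_cast hi
  induction n, hn using Nat.le_induction with
  | base => 
    have hm' : (r : ℚ) ≤ m := by exact_mod_cast hm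
    have : (2 * m + 1 : ℚ) - i - r ≠ 0 := by linarith
    simp [div_self this]
  | succ n hn ih =>
    have hn' : (r : ℚ) ≤ n := by exact_mod_cast hn
    have hm' : (n : ℚ) + 1 ≤ m := by exact_mod_cast hm
    rw [Finset.prod_Ioc_succ_top hn, ih (by omega)]
    have h1 : (2 * m + 1 : ℚ) - i - n ≠ 0 := by linarith
    have h2 : (2 * m + 1 : ℚ) - i - (n + 1) ≠ 0 := by linarith
    push_cast
    rw [div_add_one h2, div_mul_div_comm, div_eq_div_iff (mul_ne_zero h1 h2) h2]
    ring

lemma aux_c3 (m i n : ℕ) (hn : i ≤ n) (hm : n ≤ m) :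
    ∏ j ∈ Finset.Ioc i n, ((2 : ℚ) / ((2 * m + 1 : ℚ) - i - j) + 1)
      = ((2 * m + 2 : ℚ) - i - i) * ((2 * m + 1 : ℚ) - i - i) /
        (((2 * m + 2 : ℚ) - i - n) * ((2 * m + 1 : ℚ) - i - n)) := by
  induction n, hn using Nat.le_induction with
  | base => 
    have hm' : (i : ℚ) ≤ m := by exact_mod_cast hm
    have h1 : (2 * m + 1 : ℚ) - i - i ≠ 0 := by linarith
    have h2 : (2 * m + 2 : ℚ) - i - i ≠ 0 := by linarith
    simp [div_self (mul_ne_zero h2 h1)]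
  | succ n hn ih =>
    have hn' : (i : ℚ) ≤ n := by exact_mod_cast hn
    have hm' : (n : ℚ) + 1 ≤ m := by exact_mod_cast hm
    rw [Finset.prod_Ioc_succ_top hn, ih (by omega)]
    have h0 : (2 * m + 2 : ℚ) - i - n ≠ 0 := by linarith
    have h1 : (2 * m + 1 : ℚ) - i - n ≠ 0 := by linarith
    have h2 : (2 * m + 1 : ℚ) - i - (n + 1) ≠ 0 := by linarith
    have h3 : (2 * m + 2 : ℚ) - i - (n + 1) ≠ 0 := by linarith
    push_cast
    rw [div_add_one h2, div_mul_div_comm, div_eq_div_iff (mul_ne_zero (mul_ne_zero h0 h1) h2)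
      (mul_ne_zero h3 h2)]
    ring

lemma aux_prod (m r k : ℕ) (hk : k ≤ r) (hr : r ≤ m) :
    ∏ i ∈ Finset.Ioc 0 k, (((2 * m + 2 : ℚ) - i - i) * ((2 * m + 1 : ℚ) - i - i) /
        (((r : ℚ) - i + 1) * ((2 * m + 2 : ℚ) - i - r)))
    = ((2 * m).factorial * (r - k).factorial * (2 * m + 1 - r - k).factorial : ℚ) /
      ((2 * m - 2 * k).factorial * r.factorial * (2 * m + 1 - r).factorial) := by
  induction k with
  | zero =>
    have h1 := Nat.factorial_ne_zero (2 * m)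
    have h2 := Nat.factorial_ne_zero r
    have h3 := Nat.factorial_ne_zero (2 * m + 1 - r)
    simp
    field_simp
  | succ k ih =>
    rw [Finset.prod_Ioc_succ_top (Nat.zero_le k), ih (by omega)]
    obtain ⟨a, rfl⟩ := Nat.exists_eq_add_of_le hk
    obtain ⟨b, rfl⟩ := Nat.exists_eq_add_of_le hr
    have e1 : k + 1 + a - k = a + 1 := by omega
    have e2 : k + 1 + a - (k + 1) = a := by omega
    have e3 : 2 * (k + 1 + a + b) + 1 - (k + 1 + a) - k = (a + 2 * b + 1) + 1 := by omega
    have e4 : 2 * (k + 1 + a + b) + 1 - (k + 1 + a) - (k + 1) = a + 2 * b + 1 := by omega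
    have e5 : 2 * (k + 1 + a + b) - 2 * k = (2 * a + 2 * b + 1) + 1 := by omega
    have e6 : 2 * (k + 1 + a + b) - 2 * (k + 1) = 2 * a + 2 * b := by omega
    rw [e1, e2, e3, e4, e5, e6, Nat.factorial_succ a, Nat.factorial_succ (a + 2 * b + 1),
      Nat.factorial_succ (2 * a + 2 * b + 1), Nat.factorial_succ (2 * a + 2 * b)]
    have h1 : ((2 * a + 2 * b).factorial : ℚ) ≠ 0 := by exact_mod_cast Nat.factorial_ne_zero _
    have h2 : ((k + 1 + a).factorial : ℚ) ≠ 0 := by exact_mod_cast Nat.factorial_ne_zero _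
    generalize 2 * (k + 1 + a + b) + 1 - (k + 1 + a) = N
    have h3 : (N.factorial : ℚ) ≠ 0 := by exact_mod_cast Nat.factorial_ne_zero _
    generalize (2 * a + 2 * b).factorial = F1 at *
    generalize (k + 1 + a).factorial = F2 at *
    generalize N.factorial = F3 at *
    generalize (2 * (k + 1 + a + b)).factorial = F4 at *
    push_cast
    have g1 : (k + 1 + a : ℚ) - (k + 1) + 1 = a + 1 := by ring
    have g2 : (2 * (k + 1 + a + b) + 2 : ℚ) - (k + 1) - (k + 1 + a) = a + 2 * b + 1 + 1 := by ring
    have g3 : (2 * (k + 1 + a + b) + 2 : ℚ) - (k + 1) - (k + 1) = 2 * a + 2 * b + 1 + 1 := by ring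
    have g4 : (2 * (k + 1 + a + b) + 1 : ℚ) - (k + 1) - (k + 1) = 2 * a + 2 * b + 1 := by ring
    rw [g1, g2, g3, g4]
    field_simp

lemma aux_final (m r : ℕ) (hr1 : 1 ≤ r) (hr : r ≤ m) :
    ((2 * m).factorial * (r - r).factorial * (2 * m + 1 - r - r).factorial : ℚ) /
      ((2 * m - 2 * r).factorial * r.factorial * (2 * m + 1 - r).factorial)
    = (Nat.choose (2 * m) r : ℚ) - (Nat.choose (2 * m) (r - 1) : ℚ) := by
  obtain ⟨b, rfl⟩ := Nat.exists_eq_add_of_le hr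
  obtain ⟨s, rfl⟩ := Nat.exists_eq_add_of_le' hr1
  rw [Nat.cast_choose ℚ (show s + 1 ≤ 2 * (s + 1 + b) by omega),
    Nat.cast_choose ℚ (show s + 1 - 1 ≤ 2 * (s + 1 + b) by omega)]
  have e1 : 2 * (s + 1 + b) + 1 - (s + 1) - (s + 1) = 2 * b + 1 := by omega
  have e2 : 2 * (s + 1 + b) - 2 * (s + 1) = 2 * b := by omega
  have e3 : 2 * (s + 1 + b) + 1 - (s + 1) = (s + 1 + 2 * b) + 1 := by omega
  have e4 : 2 * (s + 1 + b) - (s + 1) = s + 1 + 2 * b := by omega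
  have e5 : s + 1 - 1 = s := by omega
  have e6 : 2 * (s + 1 + b) - s = (s + 1 + 2 * b) + 1 := by omega
  rw [e1, e2, e3, e4, e5, e6, Nat.sub_self, Nat.factorial_zero, Nat.factorial_succ (2 * b),
    Nat.factorial_succ (s + 1 + 2 * b), Nat.factorial_succ s]
  have h1 : ((2 * b).factorial : ℚ) ≠ 0 := by exact_mod_cast Nat.factorial_ne_zero _
  have h2 : (s.factorial : ℚ) ≠ 0 := by exact_mod_cast Nat.factorial_ne_zero _
  have h3 : ((s + 1 + 2 * b).factorial : ℚ) ≠ 0 := by exact_mod_cast Nat.factorial_ne_zero _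
  push_cast
  field_simp
  ring

theorem stmt_16 (m r : ℕ) (hm : 1 ≤ m) (hr1 : 1 ≤ r) (hrm : r ≤ m)
    (lam : ℕ → ℕ)
    (hlam1 : ∀ i, 1 ≤ i → i ≤ r → lam i = 1)
    (hlam0 : ∀ i, r < i → i ≤ m → lam i = 0) :
    (∏ i ∈ Finset.Icc 1 m, ∏ j ∈ Finset.Ioc i m,
        (((lam i : ℚ) - (lam j : ℚ)) / ((j : ℚ) - (i : ℚ)) + 1)) *
      (∏ i ∈ Finset.Icc 1 m, ∏ j ∈ Finset.Ioc i m,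
        (((lam i : ℚ) + (lam j : ℚ)) / ((2 * m + 1 : ℚ) - (i : ℚ) - (j : ℚ)) + 1)) =
      (Nat.choose (2 * m) r : ℚ) - (Nat.choose (2 * m) (r - 1) : ℚ) := by
  rw [← aux_final m r hr1 hrm, ← aux_prod m r r le_rfl hrm, ← Finset.prod_mul_distrib]
  have hI : Finset.Icc 1 m = Finset.Ioc 0 m := by ext; simp [Nat.succ_le_iff]
  rw [hI, ← Finset.prod_Ioc_consecutive _ (Nat.zero_le r) hrm]
  rw [Finset.prod_eq_one (s := Finset.Ioc r m), mul_one]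
  · refine Finset.prod_congr rfl fun i hi => ?_
    rw [Finset.mem_Ioc] at hi
    obtain ⟨hi0, hir⟩ := hi
    rw [← Finset.prod_Ioc_consecutive _ hir hrm, ← Finset.prod_Ioc_consecutive _ hir hrm]
    rw [Finset.prod_eq_one (s := Finset.Ioc i r)]
    · rw [Finset.prod_congr rfl (g := fun j : ℕ => (1 : ℚ) / ((j : ℚ) - i) + 1),
        aux_c1 i r m hir hrm,
        Finset.prod_congr (s₁ := Finset.Ioc i r) rfl
          (g := fun j : ℕ => (2 : ℚ) / ((2 * m + 1 : ℚ) - i - j) + 1),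
        aux_c3 m i r hir hrm,
        Finset.prod_congr (s₁ := Finset.Ioc r m) rfl
          (g := fun j : ℕ => (1 : ℚ) / ((2 * m + 1 : ℚ) - i - j) + 1),
        aux_c2 m i r m hir hrm le_rfl]
      · have hi' : (i : ℚ) ≤ r := by exact_mod_cast hir
        have hr' : (r : ℚ) ≤ m := by exact_mod_cast hrm
        have h1 : (r : ℚ) - i + 1 ≠ 0 := by linarith
        have h2 : (2 * m + 1 : ℚ) - i - m ≠ 0 := by linarith
        have h3 : (2 * m + 2 : ℚ) - i - r ≠ 0 := by linarith
        have h4 : (2 * m + 1 : ℚ) - i - r ≠ 0 := by linarith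
        rw [one_mul, div_mul_div_comm, div_mul_div_comm, div_eq_div_iff
          (mul_ne_zero h1 (mul_ne_zero (mul_ne_zero h3 h4) h2)) (mul_ne_zero h1 h3)]
        ring
      · intro j hj
        rw [Finset.mem_Ioc] at hj
        rw [hlam1 i hi0 hir, hlam0 j hj.1 hj.2]
        norm_num
      · intro j hj
        rw [Finset.mem_Ioc] at hj
        rw [hlam1 i hi0 hir, hlam1 j (by omega) hj.2]
        norm_num
      · intro j hj
        rw [Finset.mem_Ioc] at hj
        rw [hlam1 i hi0 hir, hlam0 j hj.1 hj.2]
        norm_num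
    · intro j hj
      rw [Finset.mem_Ioc] at hj
      rw [hlam1 i hi0 hir, hlam1 j (by omega) hj.2]
      norm_num
  · intro i hi
    rw [Finset.mem_Ioc] at hi
    rw [Finset.prod_eq_one, Finset.prod_eq_one, mul_one]
    all_goals
      intro j hj
      rw [Finset.mem_Ioc] at hj
      rw [hlam0 i hi.1 hi.2, hlam0 j (by omega) hj.2]
      norm_num
end

section
/- Let m ≥ 2 be an integer and λ : {1, …, m} → ℕ a nonincreasing sequence with λ_1 ≥ 2. Then in ℚ: ∏_{1 ≤ i < j ≤ m} ( (λ_i + λ_j)/(2m + 1 − i − j) + 1 ) ≥ 2. (This is the claim in the proof of Lemma 3 that if λ_1 ≥ 2 then the second product in the Kac–Weyl superdimension formula for 𝔬𝔰𝔭(1|2m) is at least 2.) -/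
open Finset

lemma aux_one_le {s : Finset ℕ} {f : ℕ → ℚ} (h : ∀ i ∈ s, 1 ≤ f i) : 1 ≤ ∏ i ∈ s, f i := by
  have := Finset.prod_le_prod (s := s) (f := fun _ => (1 : ℚ)) (g := f)
    (fun _ _ => zero_le_one) h
  simpa using this

lemma aux_tele (m : ℕ) (k : ℕ) (hk : 1 ≤ k) : k ≤ m → 2 ≤ m →
    ∏ j ∈ Finset.Ioc 1 k, ((2 : ℚ) / (2 * m - j) + 1)
      = (2 * m) * (2 * m - 1) / ((2 * m - k + 1) * (2 * m - k)) := by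
  induction k, hk using Nat.le_induction with
  | base =>
    intro _ h2
    have h : (2 : ℚ) ≤ m := by exact_mod_cast h2
    have h1 : (2 * (m : ℚ) - 1) ≠ 0 := by linarith
    have h3 : (m : ℚ) ≠ 0 := by linarith
    simp
    field_simp
  | succ k hk ih =>
    intro hkm h2
    have h : (2 : ℚ) ≤ m := by exact_mod_cast h2
    have h' : (k : ℚ) + 1 ≤ m := by exact_mod_cast hkm
    rw [Finset.prod_Ioc_succ_top hk, ih (by omega) h2]
    push_cast
    have e1 : (2 * (m : ℚ) - k + 1) ≠ 0 := by linarith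
    have e2 : (2 * (m : ℚ) - k) ≠ 0 := by linarith
    have e3 : (2 * (m : ℚ) - (k + 1)) ≠ 0 := by linarith
    have e4 : (2 * (m : ℚ) - (k + 1) + 1) ≠ 0 := by linarith
    field_simp
    ring

theorem stmt_18 (m : ℕ) (hm : 2 ≤ m) (lam : ℕ → ℕ)
    (hmono : ∀ i j, 1 ≤ i → i ≤ j → j ≤ m → lam j ≤ lam i)
    (hlam1 : 2 ≤ lam 1) :
    (2 : ℚ) ≤ ∏ i ∈ Finset.Icc 1 m, ∏ j ∈ Finset.Ioc i m,
        (((lam i : ℚ) + (lam j : ℚ)) / ((2 * m + 1 : ℚ) - (i : ℚ) - (j : ℚ)) + 1) := by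
  have hmq : (2 : ℚ) ≤ m := by exact_mod_cast hm
  have hrow : ∀ i ∈ Finset.Icc 1 m, (1 : ℚ) ≤ ∏ j ∈ Finset.Ioc i m,
      (((lam i : ℚ) + (lam j : ℚ)) / ((2 * m + 1 : ℚ) - (i : ℚ) - (j : ℚ)) + 1) := by
    intro i hi
    apply aux_one_le
    intro j hj
    rw [Finset.mem_Icc] at hi
    rw [Finset.mem_Ioc] at hj
    have h1 : (i : ℚ) ≤ m := by exact_mod_cast hi.2
    have h2 : (j : ℚ) ≤ m := by exact_mod_cast hj.2
    have : (0 : ℚ) ≤ ((lam i : ℚ) + (lam j : ℚ)) / ((2 * m + 1 : ℚ) - (i : ℚ) - (j : ℚ)) :=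
      div_nonneg (by positivity) (by linarith)
    linarith
  have hmem : 1 ∈ Finset.Icc 1 m := by simp; omega
  rw [← Finset.mul_prod_erase _ _ hmem]
  have hrest := aux_one_le (s := (Finset.Icc 1 m).erase 1)
    (fun i hi => hrow i (Finset.mem_of_mem_erase hi))
  have hfirst : (2 : ℚ) ≤ ∏ j ∈ Finset.Ioc 1 m,
      (((lam 1 : ℚ) + (lam j : ℚ)) / ((2 * m + 1 : ℚ) - ((1 : ℕ) : ℚ) - (j : ℚ)) + 1) := by
    have ht := aux_tele m m (by omega) le_rfl hm
    calc (2 : ℚ) ≤ (2 * m) * (2 * m - 1) / ((2 * m - m + 1) * (2 * m - m)) := by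
          rw [le_div_iff₀ (mul_pos (by linarith) (by linarith))]
          nlinarith
      _ = _ := ht.symm
      _ ≤ _ := by
          apply Finset.prod_le_prod
          · intro j hj
            rw [Finset.mem_Ioc] at hj
            have h2 : (j : ℚ) ≤ m := by exact_mod_cast hj.2
            have : (0 : ℚ) ≤ 2 / (2 * m - j) := div_nonneg (by norm_num) (by linarith)
            linarith
          · intro j hj
            rw [Finset.mem_Ioc] at hj
            have h2 : (j : ℚ) ≤ m := by exact_mod_cast hj.2
            have h3 : (2 : ℚ) ≤ lam 1 := by exact_mod_cast hlam1
            have h4 : (0 : ℚ) ≤ lam j := by positivity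
            have e : (2 * m + 1 : ℚ) - ((1 : ℕ) : ℚ) - (j : ℚ) = 2 * m - j := by
              push_cast; ring
            rw [e]
            have := div_le_div_of_nonneg_right (c := (2 * m - j : ℚ))
              (show (2 : ℚ) ≤ lam 1 + lam j by linarith) (by linarith)
            linarith
  nlinarith
end
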